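/- arXiv:2502.09942 — 6 statements merged into one kernel-verified Lean document; each statement's English description precedes it below -/
import Mathlib

section
/- Let p > 1 and q = p/(p-1). If f and g are nonnegative measurable functions on (0,∞) with f ∈ L^p(0,∞) and g ∈ L^q(0,∞), then ∫₀^∞∫₀^∞ f(x)g(y)/(x+y) dx dy ≤ (π/sin(π/p)) · (∫₀^∞ f(x)^p dx)^{1/p} · (∫₀^∞ g(y)^q dy)^{1/q}. -/
open MeasureTheory Set ENNReal

/-- The Gamma integral `∫₀^∞ t ^ (a - 1) * exp (-r t) dt` as a Lebesgue integral in `ℝ≥0∞`. -/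
lemma lintegral_rpow_mul_exp_neg_mul_Ioi {a r : ℝ} (ha : 0 < a) (hr : 0 < r) :
    ∫⁻ t in Ioi (0 : ℝ), ENNReal.ofReal (t ^ (a - 1) * Real.exp (-(r * t))) =
      ENNReal.ofReal ((1 / r) ^ a * Real.Gamma a) := by
  have key := Real.integral_rpow_mul_exp_neg_mul_Ioi ha hr
  have hG := Real.Gamma_pos_of_pos ha
  rw [← key, ofReal_integral_eq_lintegral_ofReal]
  · exact .of_integral_ne_zero (by rw [key]; positivity)
  · filter_upwards [ae_restrict_mem measurableSet_Ioi] with t ht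
    have : 0 < t := ht
    positivity

/-- The integral `∫₀^∞ y ^ (-a) / (x + y) dy`, homogeneously normalized in `x`. -/
lemma lintegral_rpow_mul_rpow_neg_div_add {a x : ℝ} (ha : 0 < a) (ha1 : a < 1) (hx : 0 < x) :
    ∫⁻ y in Ioi (0 : ℝ), ENNReal.ofReal (x ^ a * y ^ (-a) / (x + y)) =
      ENNReal.ofReal (Real.pi / Real.sin (Real.pi * a)) := by
  have hG := Real.Gamma_pos_of_pos ha
  have hG' := Real.Gamma_pos_of_pos (sub_pos.2 ha1)
  calc
    _ = ∫⁻ y in Ioi (0 : ℝ), ∫⁻ s in Ioi (0 : ℝ),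
          ENNReal.ofReal (x ^ a * y ^ (-a) * Real.exp (-((x + y) * s))) := by
      refine setLIntegral_congr_fun measurableSet_Ioi fun y (hy : 0 < y) ↦ ?_
      have h := lintegral_rpow_mul_exp_neg_mul_Ioi one_pos (add_pos hx hy)
      simp only [sub_self, Real.rpow_zero, one_mul, Real.rpow_one, Real.Gamma_one, mul_one] at h
      simp only [ENNReal.ofReal_mul (show 0 ≤ x ^ a * y ^ (-a) by positivity)]
      rw [lintegral_const_mul _ (by fun_prop), h, ← ENNReal.ofReal_mul (by positivity),
        mul_one_div]
    _ = ∫⁻ s in Ioi (0 : ℝ), ∫⁻ y in Ioi (0 : ℝ),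
          ENNReal.ofReal (x ^ a * y ^ (-a) * Real.exp (-((x + y) * s))) := by
      refine lintegral_lintegral_swap (Measurable.aemeasurable ?_)
      simp only [Function.uncurry_def]
      fun_prop
    _ = ∫⁻ s in Ioi (0 : ℝ), ENNReal.ofReal (x ^ a * Real.Gamma (1 - a)) *
          ENNReal.ofReal (s ^ (a - 1) * Real.exp (-(x * s))) := by
      refine setLIntegral_congr_fun measurableSet_Ioi fun s (hs : 0 < s) ↦ ?_
      have h := lintegral_rpow_mul_exp_neg_mul_Ioi (sub_pos.2 ha1) hs
      have hpt (y : ℝ) : ENNReal.ofReal (x ^ a * y ^ (-a) * Real.exp (-((x + y) * s))) =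
          ENNReal.ofReal (x ^ a * Real.exp (-(x * s))) *
            ENNReal.ofReal (y ^ (1 - a - 1) * Real.exp (-(s * y))) := by
        rw [← ENNReal.ofReal_mul (by positivity), show 1 - a - 1 = -a by ring,
          show -((x + y) * s) = -(x * s) + -(s * y) by ring, Real.exp_add]
        congr 1
        ring
      simp only [hpt]
      rw [lintegral_const_mul _ (by fun_prop), h, ← ENNReal.ofReal_mul (by positivity),
        ← ENNReal.ofReal_mul (by positivity), one_div, Real.inv_rpow hs.le, ← Real.rpow_neg hs.le,
        neg_sub]
      congr 1
      ring
    _ = ENNReal.ofReal (Real.pi / Real.sin (Real.pi * a)) := by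
      rw [lintegral_const_mul _ (by fun_prop), lintegral_rpow_mul_exp_neg_mul_Ioi ha hx,
        ← ENNReal.ofReal_mul (by positivity), ← Real.Gamma_mul_Gamma_one_sub, one_div,
        Real.inv_rpow hx.le]
      congr 1
      have := (Real.rpow_pos_of_pos hx a).ne'
      field_simp

/-- Integrating a function against the weighted Hilbert kernel only produces a constant. -/
lemma lintegral_lintegral_mul_rpow_div_add {a : ℝ} (ha : 0 < a) (ha1 : a < 1)
    {h : ℝ → ℝ≥0∞} (hh : Measurable h) :
    ∫⁻ x in Ioi (0 : ℝ), ∫⁻ y in Ioi (0 : ℝ),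
        h x * ENNReal.ofReal (x ^ a * y ^ (-a) / (x + y)) =
      ENNReal.ofReal (Real.pi / Real.sin (Real.pi * a)) * ∫⁻ x in Ioi (0 : ℝ), h x := by
  rw [← lintegral_const_mul _ hh]
  refine setLIntegral_congr_fun measurableSet_Ioi fun x (hx : 0 < x) ↦ ?_
  rw [lintegral_const_mul _ (by fun_prop), lintegral_rpow_mul_rpow_neg_div_add ha ha1 hx, mul_comm]

/-- Splitting of the Hilbert kernel used for Hölder's inequality. -/
lemma rpow_div_add_rpow_mul_rpow_div_add_rpow {p q x y : ℝ} (hpq : p.HolderConjugate q)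
    (hx : 0 < x) (hy : 0 < y) :
    (x ^ q⁻¹ * y ^ (-q⁻¹) / (x + y)) ^ p⁻¹ * (y ^ p⁻¹ * x ^ (-p⁻¹) / (y + x)) ^ q⁻¹ =
      (x + y)⁻¹ := by
  have hxy : 0 < x + y := add_pos hx hy
  rw [add_comm y x, Real.div_rpow (by positivity) hxy.le, Real.div_rpow (by positivity) hxy.le,
    Real.mul_rpow (by positivity) (by positivity), Real.mul_rpow (by positivity) (by positivity),
    ← Real.rpow_mul hx.le, ← Real.rpow_mul hx.le, ← Real.rpow_mul hy.le, ← Real.rpow_mul hy.le,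
    div_mul_div_comm, ← Real.rpow_add hxy, hpq.inv_add_inv_eq_one, Real.rpow_one,
    neg_mul, neg_mul, Real.rpow_neg hx.le, Real.rpow_neg hy.le, mul_comm q⁻¹ p⁻¹]
  have := (Real.rpow_pos_of_pos hx (p⁻¹ * q⁻¹)).ne'
  have := (Real.rpow_pos_of_pos hy (p⁻¹ * q⁻¹)).ne'
  field_simp

/-- Hardy–Hilbert inequality: for `p > 1`, `q = p/(p-1)`, nonnegative measurable
`f ∈ L^p(0,∞)` and `g ∈ L^q(0,∞)`,
`∫₀^∞∫₀^∞ f(x)g(y)/(x+y) dx dy ≤ (π/sin(π/p)) ‖f‖_p ‖g‖_q`. -/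
theorem stmt_0 (p q : ℝ) (hp : 1 < p) (hq : q = p / (p - 1))
    (f g : ℝ → ℝ≥0∞) (hf : Measurable f) (hg : Measurable g)
    (hfp : ∫⁻ x in Ioi (0 : ℝ), f x ^ p < ⊤)
    (hgq : ∫⁻ y in Ioi (0 : ℝ), g y ^ q < ⊤) :
    ∫⁻ y in Ioi (0 : ℝ), ∫⁻ x in Ioi (0 : ℝ), f x * g y / ENNReal.ofReal (x + y) ≤
      ENNReal.ofReal (Real.pi / Real.sin (Real.pi / p)) *
        (∫⁻ x in Ioi (0 : ℝ), f x ^ p) ^ (1 / p) *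
        (∫⁻ y in Ioi (0 : ℝ), g y ^ q) ^ (1 / q) := by
  have hpq : p.HolderConjugate q := (Real.holderConjugate_iff_eq_conjExponent hp).2 hq
  have hp0 := hpq.pos
  have hq0 := hpq.symm.pos
  have hsin : Real.sin (Real.pi * q⁻¹) = Real.sin (Real.pi / p) := by
    rw [← hpq.one_sub_inv, mul_sub, mul_one, Real.sin_pi_sub, div_eq_mul_inv]
  set μ := (volume : Measure ℝ).restrict (Ioi 0) with hμ
  set F : ℝ × ℝ → ℝ≥0∞ := fun z ↦
    f z.1 * ENNReal.ofReal (z.1 ^ q⁻¹ * z.2 ^ (-q⁻¹) / (z.1 + z.2)) ^ p⁻¹ with hF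
  set G : ℝ × ℝ → ℝ≥0∞ := fun z ↦
    g z.2 * ENNReal.ofReal (z.2 ^ p⁻¹ * z.1 ^ (-p⁻¹) / (z.2 + z.1)) ^ q⁻¹ with hG
  have hFm : Measurable F := by fun_prop
  have hGm : Measurable G := by fun_prop
  have hFint : ∫⁻ z, F z ^ p ∂μ.prod μ =
      ENNReal.ofReal (Real.pi / Real.sin (Real.pi / p)) * ∫⁻ x, f x ^ p ∂μ := by
    rw [lintegral_prod _ (hFm.pow_const p).aemeasurable, ← hsin,
      ← lintegral_lintegral_mul_rpow_div_add (inv_pos.2 hq0) (inv_lt_one_of_one_lt₀ hpq.symm.lt)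
        (hf.pow_const p)]
    simp only [hF, ENNReal.mul_rpow_of_nonneg _ _ hp0.le, ENNReal.rpow_inv_rpow hp0.ne', hμ]
  have hGint : ∫⁻ z, G z ^ q ∂μ.prod μ =
      ENNReal.ofReal (Real.pi / Real.sin (Real.pi / p)) * ∫⁻ y, g y ^ q ∂μ := by
    rw [lintegral_prod_symm _ (hGm.pow_const q).aemeasurable, div_eq_mul_inv Real.pi p,
      ← lintegral_lintegral_mul_rpow_div_add (inv_pos.2 hp0) (inv_lt_one_of_one_lt₀ hp)
        (hg.pow_const q)]
    simp only [hG, ENNReal.mul_rpow_of_nonneg _ _ hq0.le, ENNReal.rpow_inv_rpow hq0.ne', hμ]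
  have hFG : ∫⁻ y, ∫⁻ x, f x * g y / ENNReal.ofReal (x + y) ∂μ ∂μ =
      ∫⁻ z, (F * G) z ∂μ.prod μ := by
    rw [lintegral_prod_symm _ (hFm.mul hGm).aemeasurable]
    refine setLIntegral_congr_fun measurableSet_Ioi fun y (hy : 0 < y) ↦ ?_
    refine setLIntegral_congr_fun measurableSet_Ioi fun x (hx : 0 < x) ↦ ?_
    simp only [Pi.mul_apply, hF, hG]
    rw [mul_mul_mul_comm, ENNReal.ofReal_rpow_of_nonneg (by positivity) (by positivity),
      ENNReal.ofReal_rpow_of_nonneg (by positivity) (by positivity),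
      ← ENNReal.ofReal_mul (by positivity), rpow_div_add_rpow_mul_rpow_div_add_rpow hpq hx hy,
      ENNReal.ofReal_inv_of_pos (add_pos hx hy), div_eq_mul_inv]
  rw [hFG]
  refine (ENNReal.lintegral_mul_le_Lp_mul_Lq _ hpq hFm.aemeasurable hGm.aemeasurable).trans_eq ?_
  rw [hFint, hGint, ENNReal.mul_rpow_of_nonneg _ _ (by positivity),
    ENNReal.mul_rpow_of_nonneg _ _ (by positivity), mul_mul_mul_comm,
    ← ENNReal.rpow_add_of_nonneg _ _ (by positivity) (by positivity), one_div, one_div,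
    hpq.inv_add_inv_eq_one, ENNReal.rpow_one, mul_assoc]
end

section
/- Let p > 1, k > 1, 1/p + 1/q = 1, 1/k + 1/m = 1, and λ > 0. If f and g are nonnegative measurable functions on (0,∞) with 0 < ∫₀^∞ x^{p(1−λ/k)−1} f(x)^p dx < ∞ and 0 < ∫₀^∞ y^{q(1−λ/m)−1} g(y)^q dy < ∞, then ∫₀^∞∫₀^∞ f(x)g(y)/(x^λ + y^λ) dx dy ≤ (π/(λ sin(π/m))) · (∫₀^∞ x^{p(1−λ/k)−1} f(x)^p dx)^{1/p} · (∫₀^∞ y^{q(1−λ/m)−1} g(y)^q dy)^{1/q}. -/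
open MeasureTheory Set ENNReal

/-- The gamma-type integral `∫₀^∞ x ^ a * exp (-b * x ^ r)` as a lower Lebesgue integral. -/
lemma lintegral_rpow_mul_exp_neg_mul_rpow {a b r : ℝ} (ha : -1 < a) (hb : 0 < b) (hr : 0 < r) :
    ∫⁻ x in Ioi (0 : ℝ), ENNReal.ofReal (x ^ a * Real.exp (-b * x ^ r)) =
      ENNReal.ofReal (b ^ (-(a + 1) / r) * (1 / r) * Real.Gamma ((a + 1) / r)) := by
  have hint := integral_rpow_mul_exp_neg_mul_rpow hr ha hb
  have hpos : 0 < b ^ (-(a + 1) / r) * (1 / r) * Real.Gamma ((a + 1) / r) := by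
    have := Real.Gamma_pos_of_pos (s := (a + 1) / r) (by apply div_pos <;> linarith)
    positivity
  rw [← hint] at hpos ⊢
  rw [ofReal_integral_eq_lintegral_ofReal (not_imp_comm.1 integral_undef hpos.ne')]
  filter_upwards [ae_restrict_mem measurableSet_Ioi] with x hx
  have : (0 : ℝ) < x := hx
  positivity

/-- The Beta-type integral `∫₀^∞ y ^ (l * s - 1) / (x ^ l + y ^ l) dy`, for `0 < s < 1`. -/
lemma lintegral_rpow_div_rpow_add_rpow {l s x : ℝ} (hl : 0 < l) (hs : 0 < s) (hs1 : s < 1)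
    (hx : 0 < x) :
    ∫⁻ y in Ioi (0 : ℝ), ENNReal.ofReal (y ^ (l * s - 1) / (x ^ l + y ^ l)) =
      ENNReal.ofReal (Real.pi / (l * Real.sin (Real.pi * s)) * x ^ (l * (s - 1))) := by
  have hls : 0 < l * s := mul_pos hl hs
  have hxl : 0 < x ^ l := Real.rpow_pos_of_pos hx l
  have inner_u (y : ℝ) (hy : y ∈ Ioi (0 : ℝ)) :
      ENNReal.ofReal (y ^ (l * s - 1) / (x ^ l + y ^ l)) = ∫⁻ u in Ioi (0 : ℝ),
        ENNReal.ofReal (y ^ (l * s - 1) * Real.exp (-(x ^ l + y ^ l) * u)) := by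
    have hy : 0 < y := hy
    have h := lintegral_rpow_mul_exp_neg_mul_rpow (a := 0) (b := x ^ l + y ^ l) (r := 1)
      (by norm_num) (by positivity) one_pos
    simp only [Real.rpow_zero, one_mul, Real.rpow_one, zero_add, div_one, mul_one, Real.Gamma_one,
      Real.rpow_neg_one] at h
    simp_rw [ENNReal.ofReal_mul (Real.rpow_nonneg hy.le (l * s - 1))]
    rw [lintegral_const_mul _ (by fun_prop), h, div_eq_mul_inv,
      ENNReal.ofReal_mul (by positivity)]
  have inner_y (u : ℝ) (hu : u ∈ Ioi (0 : ℝ)) :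
      ∫⁻ y in Ioi (0 : ℝ), ENNReal.ofReal (y ^ (l * s - 1) * Real.exp (-(x ^ l + y ^ l) * u)) =
        ENNReal.ofReal (1 / l * Real.Gamma s) *
          ENNReal.ofReal (u ^ (-s) * Real.exp (-x ^ l * u ^ (1 : ℝ))) := by
    have hu : 0 < u := hu
    have h := lintegral_rpow_mul_exp_neg_mul_rpow (a := l * s - 1) (by linarith) hu hl
    have e1 : (l * s - 1 + 1) / l = s := by rw [sub_add_cancel, mul_div_cancel_left₀ _ hl.ne']
    have e2 : -(l * s - 1 + 1) / l = -s := by rw [neg_div, e1]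
    rw [e1, e2] at h
    have hsplit (y : ℝ) : ENNReal.ofReal (y ^ (l * s - 1) * Real.exp (-(x ^ l + y ^ l) * u)) =
        ENNReal.ofReal (Real.exp (-x ^ l * u)) *
          ENNReal.ofReal (y ^ (l * s - 1) * Real.exp (-u * y ^ l)) := by
      rw [← ENNReal.ofReal_mul (Real.exp_nonneg _), mul_left_comm, ← Real.exp_add]
      ring_nf
    have hG := Real.Gamma_pos_of_pos hs
    simp_rw [hsplit]
    rw [lintegral_const_mul _ (by fun_prop), h, ← ENNReal.ofReal_mul (Real.exp_nonneg _),
      ← ENNReal.ofReal_mul (by positivity), Real.rpow_one]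
    ring_nf
  rw [setLIntegral_congr_fun measurableSet_Ioi inner_u, lintegral_lintegral_swap (by fun_prop),
    setLIntegral_congr_fun measurableSet_Ioi inner_y, lintegral_const_mul _ (by fun_prop),
    lintegral_rpow_mul_exp_neg_mul_rpow (by linarith) hxl one_pos,
    ← ENNReal.ofReal_mul (by have := Real.Gamma_pos_of_pos hs; positivity)]
  congr 1
  have hrefl := Real.Gamma_mul_Gamma_one_sub s
  rw [← Real.rpow_mul hx.le, div_one, div_one, show -s + 1 = 1 - s by ring,
    show l * -(1 - s) = l * (s - 1) by ring, mul_comm l (Real.sin _), ← div_div, ← hrefl]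
  ring_nf

/-- Integrating out the second variable of the weighted kernel `1 / (x ^ l + y ^ l)`. -/
lemma lintegral_lintegral_rpow_div_rpow_add_rpow {l s : ℝ} (p : ℝ) (hl : 0 < l) (hs : 0 < s)
    (hs1 : s < 1) {f : ℝ → ℝ≥0∞} (hf : Measurable f) :
    ∫⁻ x in Ioi (0 : ℝ), ∫⁻ y in Ioi (0 : ℝ),
        ENNReal.ofReal (x ^ ((1 - l * (1 - s)) * (p - 1))) * f x ^ p *
          ENNReal.ofReal (y ^ (l * s - 1) / (x ^ l + y ^ l)) =
      ENNReal.ofReal (Real.pi / (l * Real.sin (Real.pi * s))) *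
        ∫⁻ x in Ioi (0 : ℝ), ENNReal.ofReal (x ^ (p * (1 - l * (1 - s)) - 1)) * f x ^ p := by
  rw [← lintegral_const_mul _ (by fun_prop)]
  refine setLIntegral_congr_fun measurableSet_Ioi fun x hx => ?_
  have hx : 0 < x := hx
  have hsin : 0 < Real.sin (Real.pi * s) :=
    Real.sin_pos_of_pos_of_lt_pi (by positivity) (by nlinarith [Real.pi_pos])
  rw [lintegral_const_mul _ (by fun_prop), lintegral_rpow_div_rpow_add_rpow hl hs hs1 hx,
    ENNReal.ofReal_mul (by positivity),
    show p * (1 - l * (1 - s)) - 1 = (1 - l * (1 - s)) * (p - 1) + l * (s - 1) by ring,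
    Real.rpow_add hx, ENNReal.ofReal_mul (by positivity)]
  ring

lemma mul_ofReal_rpow_mul_rpow_mul_rpow_rpow {p x y K : ℝ} (a b : ℝ) (hp : 0 < p) (hx : 0 < x)
    (hy : 0 < y) (hK : 0 < K) (t : ℝ≥0∞) :
    (t * ENNReal.ofReal (x ^ a * y ^ b * K ^ (1 / p))) ^ p =
      ENNReal.ofReal (x ^ (a * p)) * t ^ p * ENNReal.ofReal (y ^ (b * p) * K) := by
  rw [ENNReal.mul_rpow_of_nonneg _ _ hp.le, ENNReal.ofReal_rpow_of_pos (by positivity),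
    Real.mul_rpow (by positivity) (by positivity), Real.mul_rpow (by positivity) (by positivity),
    ← Real.rpow_mul hx.le, ← Real.rpow_mul hy.le, ← Real.rpow_mul hK.le,
    one_div_mul_cancel hp.ne', Real.rpow_one, mul_assoc, ENNReal.ofReal_mul (by positivity)]
  ring

/-- Weighted Hardy–Hilbert type inequality with kernel `1/(x^λ + y^λ)` on `(0,∞)`:
for `p, k > 1`, `1/p + 1/q = 1/k + 1/m = 1`, `λ > 0`. -/
theorem stmt_3 (p q k m l : ℝ) (hp : 1 < p) (hk : 1 < k)
    (hpq : 1 / p + 1 / q = 1) (hkm : 1 / k + 1 / m = 1) (hl : 0 < l)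
    (f g : ℝ → ℝ≥0∞) (hf : Measurable f) (hg : Measurable g)
    (hfp : 0 < ∫⁻ x in Ioi (0 : ℝ), ENNReal.ofReal (x ^ (p * (1 - l / k) - 1)) * f x ^ p)
    (hfp' : ∫⁻ x in Ioi (0 : ℝ), ENNReal.ofReal (x ^ (p * (1 - l / k) - 1)) * f x ^ p < ⊤)
    (hgq : 0 < ∫⁻ y in Ioi (0 : ℝ), ENNReal.ofReal (y ^ (q * (1 - l / m) - 1)) * g y ^ q)
    (hgq' : ∫⁻ y in Ioi (0 : ℝ), ENNReal.ofReal (y ^ (q * (1 - l / m) - 1)) * g y ^ q < ⊤) :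
    ∫⁻ y in Ioi (0 : ℝ), ∫⁻ x in Ioi (0 : ℝ),
        f x * g y / ENNReal.ofReal (x ^ l + y ^ l) ≤
      ENNReal.ofReal (Real.pi / (l * Real.sin (Real.pi / m))) *
        (∫⁻ x in Ioi (0 : ℝ), ENNReal.ofReal (x ^ (p * (1 - l / k) - 1)) * f x ^ p) ^ (1 / p) *
        (∫⁻ y in Ioi (0 : ℝ), ENNReal.ofReal (y ^ (q * (1 - l / m) - 1)) * g y ^ q) ^ (1 / q) := by
  have hq : 1 < q := by
    have hp1 : 1 / p < 1 := by rw [div_lt_one (by linarith)]; exact hp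
    have hp0 : 0 < 1 / p := by positivity
    have hq0 : 0 < q := one_div_pos.1 (by linarith)
    have : 1 / q < 1 := by linarith
    rwa [div_lt_one hq0] at this
  have hp0 : 0 < p := by linarith
  have hq0 : 0 < q := by linarith
  have hk1 : 1 / k < 1 := by rw [div_lt_one (by linarith)]; exact hk
  have hk0 : 0 < 1 / k := by positivity
  have hm0 : 0 < 1 / m := by linarith
  have hm1 : 1 / m < 1 := by linarith
  have hconj : p.HolderConjugate q :=
    Real.holderConjugate_iff.2 ⟨hp, by simpa only [one_div] using hpq⟩
  have hpm : p * (1 / q) = p - 1 := by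
    rw [show 1 / q = 1 - 1 / p by linarith]; field_simp
  have hqm : q * (1 / p) = q - 1 := by
    rw [show 1 / p = 1 - 1 / q by linarith]; field_simp
  have hsin : Real.sin (Real.pi * (1 / k)) = Real.sin (Real.pi * (1 / m)) := by
    rw [show 1 / k = 1 - 1 / m by linarith, mul_sub, mul_one, Real.sin_pi_sub]
  have hA := lintegral_lintegral_rpow_div_rpow_add_rpow p hl hm0 hm1 hf
  have hB := lintegral_lintegral_rpow_div_rpow_add_rpow q hl hk0 hk1 hg
  rw [show 1 - 1 / m = 1 / k by linarith] at hA
  rw [show 1 - 1 / k = 1 / m by linarith, hsin] at hB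
  set α : ℝ := (1 - l * (1 / k)) * (1 / q) with hα
  set β : ℝ := (1 - l * (1 / m)) * (1 / p) with hβ
  have hαp : α * p = (1 - l * (1 / k)) * (p - 1) := by rw [hα, ← hpm]; ring
  have hαq : -α * q = l * (1 / k) - 1 := by rw [hα]; field_simp; ring
  have hβq : β * q = (1 - l * (1 / m)) * (q - 1) := by rw [hβ, ← hqm]; ring
  have hβp : -β * p = l * (1 / m) - 1 := by rw [hβ]; field_simp; ring
  let F : ℝ × ℝ → ℝ≥0∞ := fun z => f z.1 *
    ENNReal.ofReal (z.1 ^ α * z.2 ^ (-β) * (1 / (z.1 ^ l + z.2 ^ l)) ^ (1 / p))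
  let G : ℝ × ℝ → ℝ≥0∞ := fun z => g z.2 *
    ENNReal.ofReal (z.2 ^ β * z.1 ^ (-α) * (1 / (z.1 ^ l + z.2 ^ l)) ^ (1 / q))
  have hF : Measurable F := by fun_prop
  have hG : Measurable G := by fun_prop
  let μ : Measure ℝ := volume.restrict (Ioi 0)
  have hholder := lintegral_mul_le_Lp_mul_Lq (μ.prod μ) hconj hF.aemeasurable hG.aemeasurable
  rw [lintegral_prod_symm' _ (hF.mul hG), lintegral_prod _ (hF.pow_const p).aemeasurable,
    lintegral_prod_symm' _ (hG.pow_const q)] at hholder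
  have hFG : ∫⁻ y in Ioi (0 : ℝ), ∫⁻ x in Ioi (0 : ℝ),
      f x * g y / ENNReal.ofReal (x ^ l + y ^ l) = ∫⁻ y, ∫⁻ x, (F * G) (x, y) ∂μ ∂μ := by
    refine setLIntegral_congr_fun measurableSet_Ioi fun y hy =>
      setLIntegral_congr_fun measurableSet_Ioi fun x hx => ?_
    have hx : 0 < x := hx
    have hy : 0 < y := hy
    have hK : 0 < 1 / (x ^ l + y ^ l) := by positivity
    have hw : (x ^ α * y ^ (-β) * (1 / (x ^ l + y ^ l)) ^ (1 / p)) *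
        (y ^ β * x ^ (-α) * (1 / (x ^ l + y ^ l)) ^ (1 / q)) = (x ^ l + y ^ l)⁻¹ := by
      calc _ = (x ^ α * x ^ (-α)) * (y ^ β * y ^ (-β)) *
            ((1 / (x ^ l + y ^ l)) ^ (1 / p) * (1 / (x ^ l + y ^ l)) ^ (1 / q)) := by ring
        _ = _ := by
          rw [← Real.rpow_add hx, ← Real.rpow_add hy, ← Real.rpow_add hK, hpq]
          simp
    simp only [Pi.mul_apply, F, G]
    rw [mul_mul_mul_comm, ← ENNReal.ofReal_mul (by positivity), hw,
      ENNReal.ofReal_inv_of_pos (by positivity), div_eq_mul_inv]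
  have hFp : ∫⁻ x, ∫⁻ y, F (x, y) ^ p ∂μ ∂μ = _ := Eq.trans (by
    refine setLIntegral_congr_fun measurableSet_Ioi fun x hx =>
      setLIntegral_congr_fun measurableSet_Ioi fun y hy => ?_
    have hx : 0 < x := hx
    have hy : 0 < y := hy
    simp only [F]
    rw [mul_ofReal_rpow_mul_rpow_mul_rpow_rpow _ _ hp0 hx hy (by positivity), hαp, hβp,
      mul_one_div (_ ^ _)]) hA
  have hGq : ∫⁻ y, ∫⁻ x, G (x, y) ^ q ∂μ ∂μ = _ := Eq.trans (by
    refine setLIntegral_congr_fun measurableSet_Ioi fun y hy =>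
      setLIntegral_congr_fun measurableSet_Ioi fun x hx => ?_
    have hx : 0 < x := hx
    have hy : 0 < y := hy
    simp only [G]
    rw [mul_ofReal_rpow_mul_rpow_mul_rpow_rpow _ _ hq0 hy hx (by positivity), hαq, hβq,
      mul_one_div (_ ^ _), add_comm (x ^ l)]) hB
  rw [hFG]
  refine hholder.trans_eq ?_
  rw [hFp, hGq, ENNReal.mul_rpow_of_nonneg _ _ (by positivity),
    ENNReal.mul_rpow_of_nonneg _ _ (by positivity), mul_mul_mul_comm,
    ← ENNReal.rpow_add_of_nonneg _ _ (by positivity) (by positivity), hpq, ENNReal.rpow_one]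
  simp only [mul_one_div, mul_assoc]
end

section
/- Let p > 1, q = p/(p-1), and let k be a nonnegative measurable kernel on (0,∞)×(0,∞) that is homogeneous of order −1, i.e. k(ax, ay) = a^{−1} k(x,y) for all x, y, a > 0. If C_p* := ∫₀^∞ k(1,y) y^{−1/p} dy < ∞, then for every nonnegative measurable function f on (0,∞): ∫₀^∞ (∫₀^∞ k(x,y) f(y) dy)^p dx ≤ (C_p*)^p ∫₀^∞ f(x)^p dx. -/
open MeasureTheory Set ENNReal

theorem lintegral_Ioi_comp_mul_left {g : ℝ → ℝ≥0∞} (hg : Measurable g) {a : ℝ} (ha : 0 < a) :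
    ∫⁻ x in Ioi (0 : ℝ), g (a * x) = ENNReal.ofReal a⁻¹ * ∫⁻ x in Ioi (0 : ℝ), g x := by
  have h : ∀ x, (Ioi (0 : ℝ)).indicator (fun x => g (a * x)) x =
      (Ioi (0 : ℝ)).indicator g (a * x) := by
    intro x
    simp only [indicator, mem_Ioi, mul_pos_iff_of_pos_left ha]
  rw [← lintegral_indicator measurableSet_Ioi, ← lintegral_indicator measurableSet_Ioi]
  simp_rw [h]
  rw [← lintegral_map (hg.indicator measurableSet_Ioi) (measurable_const_mul a),
    Real.map_volume_mul_left ha.ne', lintegral_smul_measure, abs_of_pos (inv_pos.2 ha),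
    smul_eq_mul]

/-- Weighted Hölder inequality, in the form of a bound for the `p`-th power of an integral. -/
theorem lintegral_rpow_le_lintegral_weight_mul {α : Type*} [MeasurableSpace α] {μ : Measure α}
    {p : ℝ} (hp : 1 < p) {k w g : α → ℝ≥0∞} (hk : Measurable k) (hw : Measurable w)
    (hg : Measurable g) (hw0 : ∀ᵐ t ∂μ, w t ≠ 0) (hwt : ∀ᵐ t ∂μ, w t ≠ ⊤) :
    (∫⁻ t, k t * g t ∂μ) ^ p ≤
      (∫⁻ t, k t * w t ∂μ) ^ (p - 1) * ∫⁻ t, k t * (w t ^ (1 - p) * g t ^ p) ∂μ := by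
  have hp0 : 0 < p := by linarith
  have hpq := (Real.HolderConjugate.conjExponent hp).symm
  set q := p.conjExponent with hq
  have hq0 : 0 < q := hpq.pos
  have hqp : q⁻¹ * p = p - 1 := by
    rw [hq, Real.conjExponent]; field_simp
  have hpq' : -q⁻¹ * p = 1 - p := by linarith
  have H := ENNReal.lintegral_mul_le_Lp_mul_Lq (μ.withDensity k) hpq
    (f := fun t => w t ^ q⁻¹) (g := fun t => w t ^ (-q⁻¹) * g t)
    (hw.pow_const _).aemeasurable ((hw.pow_const _).mul hg).aemeasurable
  have e1 : ∫⁻ t, ((fun t => w t ^ q⁻¹) * fun t => w t ^ (-q⁻¹) * g t) t ∂(μ.withDensity k) =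
      ∫⁻ t, k t * g t ∂μ := by
    refine (lintegral_withDensity_eq_lintegral_mul _ hk
      ((hw.pow_const _).mul ((hw.pow_const _).mul hg))).trans ?_
    refine lintegral_congr_ae ?_
    filter_upwards [hw0, hwt] with t h0 ht
    simp only [Pi.mul_apply]
    rw [← mul_assoc (w t ^ q⁻¹), ← ENNReal.rpow_add _ _ h0 ht, add_neg_cancel, ENNReal.rpow_zero,
      one_mul]
  have e2 : ∫⁻ t, (w t ^ q⁻¹) ^ q ∂(μ.withDensity k) = ∫⁻ t, k t * w t ∂μ := by
    simp_rw [ENNReal.rpow_inv_rpow hq0.ne']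
    exact lintegral_withDensity_eq_lintegral_mul _ hk hw
  have e3 : ∫⁻ t, (w t ^ (-q⁻¹) * g t) ^ p ∂(μ.withDensity k) =
      ∫⁻ t, k t * (w t ^ (1 - p) * g t ^ p) ∂μ := by
    simp_rw [ENNReal.mul_rpow_of_nonneg _ _ hp0.le, ← ENNReal.rpow_mul, hpq']
    exact lintegral_withDensity_eq_lintegral_mul _ hk ((hw.pow_const _).mul (hg.pow_const _))
  rw [e1, e2, e3] at H
  calc _ ≤ _ := ENNReal.rpow_le_rpow H hp0.le
    _ = _ := by
      rw [ENNReal.mul_rpow_of_nonneg _ _ hp0.le, ← ENNReal.rpow_mul, ← ENNReal.rpow_mul,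
        one_div, one_div, hqp, inv_mul_cancel₀ hp0.ne', ENNReal.rpow_one]

/-- Hardy-type inequality for a kernel homogeneous of order `−1` on `(0,∞)×(0,∞)`:
if `C_p* = ∫₀^∞ k(1,y) y^{−1/p} dy < ∞` then
`∫₀^∞ (∫₀^∞ k(x,y) f(y) dy)^p dx ≤ (C_p*)^p ∫₀^∞ f^p`. -/
theorem stmt_5 (p q : ℝ) (hp : 1 < p) (hq : q = p / (p - 1))
    (k : ℝ → ℝ → ℝ≥0∞) (hk : Measurable (Function.uncurry k))
    (hk_hom : ∀ a x y : ℝ, 0 < a → 0 < x → 0 < y →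
      k (a * x) (a * y) = ENNReal.ofReal (a ^ (-1 : ℝ)) * k x y)
    (hCp : ∫⁻ y in Ioi (0 : ℝ), k 1 y * ENNReal.ofReal (y ^ (-(1 / p))) < ⊤) :
    ∀ f : ℝ → ℝ≥0∞, Measurable f →
      ∫⁻ x in Ioi (0 : ℝ), (∫⁻ y in Ioi (0 : ℝ), k x y * f y) ^ p ≤
        (∫⁻ y in Ioi (0 : ℝ), k 1 y * ENNReal.ofReal (y ^ (-(1 / p)))) ^ p *
          ∫⁻ x in Ioi (0 : ℝ), f x ^ p := by
  intro f hf
  have hp0 : 0 < p := by linarith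
  have hkx : ∀ x, Measurable (k x) := fun x => hk.comp measurable_prodMk_left
  set w : ℝ → ℝ≥0∞ := fun t => ENNReal.ofReal (t ^ (-(1 / p))) with hw
  have hwm : Measurable w := by fun_prop
  have substitution : ∀ x ∈ Ioi (0 : ℝ),
      ∫⁻ y in Ioi (0 : ℝ), k x y * f y = ∫⁻ t in Ioi (0 : ℝ), k 1 t * f (x * t) := by
    intro x hx
    have hx0 : (0 : ℝ) < x := hx
    have hne : ENNReal.ofReal x⁻¹ ≠ 0 := by simpa using hx0
    refine (ENNReal.mul_right_inj hne ENNReal.ofReal_ne_top).1 ?_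
    refine (lintegral_Ioi_comp_mul_left ((hkx x).mul hf) hx0).symm.trans ?_
    rw [← lintegral_const_mul' _ _ ENNReal.ofReal_ne_top]
    refine setLIntegral_congr_fun measurableSet_Ioi fun t ht => ?_
    have := hk_hom x 1 t hx0 one_pos ht
    rw [mul_one, Real.rpow_neg_one] at this
    simp only [Pi.mul_apply, this, mul_assoc]
  have weight : ∀ t ∈ Ioi (0 : ℝ), w t ^ (1 - p) * ENNReal.ofReal t⁻¹ = w t := by
    intro t ht
    have ht0 : (0 : ℝ) < t := ht
    simp only [hw]
    rw [ENNReal.ofReal_rpow_of_pos (by positivity), ← ENNReal.ofReal_mul (by positivity),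
      ← Real.rpow_mul ht0.le, ← Real.rpow_neg_one, ← Real.rpow_add ht0]
    congr 2
    field_simp
    ring
  calc ∫⁻ x in Ioi (0 : ℝ), (∫⁻ y in Ioi (0 : ℝ), k x y * f y) ^ p
      = ∫⁻ x in Ioi (0 : ℝ), (∫⁻ t in Ioi (0 : ℝ), k 1 t * f (x * t)) ^ p :=
        setLIntegral_congr_fun measurableSet_Ioi fun x hx => by simp only [substitution x hx]
    _ ≤ ∫⁻ x in Ioi (0 : ℝ), (∫⁻ t in Ioi (0 : ℝ), k 1 t * w t) ^ (p - 1) *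
          ∫⁻ t in Ioi (0 : ℝ), k 1 t * (w t ^ (1 - p) * f (x * t) ^ p) := by
        refine lintegral_mono fun x => ?_
        refine lintegral_rpow_le_lintegral_weight_mul hp (hkx 1) hwm (by fun_prop) ?_
          (Filter.Eventually.of_forall fun t => ENNReal.ofReal_ne_top)
        filter_upwards [self_mem_ae_restrict measurableSet_Ioi] with t ht
        exact (ENNReal.ofReal_pos.2 (Real.rpow_pos_of_pos ht _)).ne'
    _ = (∫⁻ t in Ioi (0 : ℝ), k 1 t * w t) ^ (p - 1) * ∫⁻ t in Ioi (0 : ℝ),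
          ∫⁻ x in Ioi (0 : ℝ), k 1 t * (w t ^ (1 - p) * f (x * t) ^ p) := by
        have hm : Measurable fun z : ℝ × ℝ =>
            k 1 z.2 * (w z.2 ^ (1 - p) * f (z.1 * z.2) ^ p) := by
          have := hkx 1
          fun_prop
        rw [lintegral_const_mul _ hm.lintegral_prod_right', lintegral_lintegral_swap hm.aemeasurable]
    _ = (∫⁻ t in Ioi (0 : ℝ), k 1 t * w t) ^ (p - 1) *
          ((∫⁻ t in Ioi (0 : ℝ), k 1 t * w t) * ∫⁻ x in Ioi (0 : ℝ), f x ^ p) := by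
        congr 1
        refine Eq.trans ?_ (lintegral_mul_const _ ((hkx 1).mul hwm))
        refine setLIntegral_congr_fun measurableSet_Ioi fun t ht => ?_
        simp only [mul_comm _ t]
        rw [lintegral_const_mul _ (by fun_prop), lintegral_const_mul _ (by fun_prop),
          lintegral_Ioi_comp_mul_left (hf.pow_const p) ht, ← mul_assoc (w t ^ (1 - p)),
          weight t ht, mul_assoc]
    _ = _ := by
        have rpow_split (C : ℝ≥0∞) : C ^ (p - 1) * C = C ^ p := by
          simpa using (ENNReal.rpow_add_of_nonneg (x := C) (p - 1) 1 (by linarith) zero_le_one).symm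
        rw [← mul_assoc, rpow_split]
end

section
/- Let p > 1, q = p/(p-1), and let k be a nonnegative measurable kernel on (0,∞)×(0,∞) homogeneous of order −1. If there is a finite constant C such that ∫₀^∞ (∫₀^∞ k(x,y) f(y) dy)^p dx ≤ C ∫₀^∞ f(x)^p dx for all nonnegative measurable functions f on (0,∞), then C_p* := ∫₀^∞ k(1,y) y^{−1/p} dy is finite and (C_p*)^p ≤ C. -/
open MeasureTheory Set ENNReal

lemma setLIntegral_Ioc_ofReal_inv {a b : ℝ} (hab : a ≤ b) :
    ∫⁻ x in Ioc (Real.exp a) (Real.exp b), ENNReal.ofReal x⁻¹ = ENNReal.ofReal (b - a) := by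
  have hle : Real.exp a ≤ Real.exp b := Real.exp_le_exp.2 hab
  have hint : IntervalIntegrable (fun x : ℝ => x⁻¹) volume (Real.exp a) (Real.exp b) :=
    intervalIntegral.intervalIntegrable_inv
      (fun x hx => by
        rw [uIcc_of_le hle] at hx
        exact ((Real.exp_pos a).trans_le hx.1).ne')
      continuousOn_id
  rw [← ofReal_integral_eq_lintegral_ofReal, ← intervalIntegral.integral_of_le hle,
    integral_inv_of_pos (Real.exp_pos _) (Real.exp_pos _), ← Real.exp_sub, Real.log_exp]
  · exact (intervalIntegrable_iff_integrableOn_Ioc_of_le hle).1 hint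
  · filter_upwards [ae_restrict_mem measurableSet_Ioc] with x hx
    exact inv_nonneg.2 ((Real.exp_pos a).trans hx.1).le

lemma ofReal_rpow_neg_one_div_rpow {p x : ℝ} (hp : 0 < p) (hx : 0 < x) :
    ENNReal.ofReal (x ^ (-(1 / p))) ^ p = ENNReal.ofReal x⁻¹ := by
  rw [ENNReal.ofReal_rpow_of_nonneg (by positivity) hp.le, ← Real.rpow_mul hx.le,
    ← Real.rpow_neg_one]
  congr 2
  field_simp

lemma ENNReal.le_of_forall_nat_mul_le {A C : ℝ≥0∞} {m : ℝ} (hm : 0 < m) (hC : C ≠ ⊤)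
    (h : ∀ n : ℕ, A * ENNReal.ofReal (m * n) ≤ C * ENNReal.ofReal (m * (n + 2))) : A ≤ C := by
  have hA : A ≠ ⊤ := by
    rintro rfl
    have h1 := h 1
    rw [ENNReal.top_mul (by simpa using hm), top_le_iff] at h1
    exact ENNReal.mul_ne_top hC ENNReal.ofReal_ne_top h1
  lift A to NNReal using hA
  lift C to NNReal using hC
  rw [ENNReal.coe_le_coe, ← NNReal.coe_le_coe]
  by_contra! hlt
  obtain ⟨n, hn⟩ := exists_nat_gt (2 * (C : ℝ) / (A - C))
  rw [div_lt_iff₀ (sub_pos.2 hlt)] at hn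
  have h1 := ENNReal.toReal_mono (ENNReal.mul_ne_top ENNReal.coe_ne_top ENNReal.ofReal_ne_top) (h n)
  rw [ENNReal.toReal_mul, ENNReal.toReal_mul, ENNReal.toReal_ofReal (by positivity),
    ENNReal.toReal_ofReal (by positivity), ENNReal.coe_toReal, ENNReal.coe_toReal] at h1
  have h2 : m * (A * n) ≤ m * (C * (n + 2)) := by linarith
  have h3 := le_of_mul_le_mul_left h2 hm
  linarith

/-- Inner integral of a homogeneous kernel against a truncated power, bounded below by the
truncated constant. -/
lemma rpow_mul_setLIntegral_le_of_homogeneous {p : ℝ} {k : ℝ → ℝ → ℝ≥0∞}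
    (hk_hom : ∀ a x y : ℝ, 0 < a → 0 < x → 0 < y →
      k (a * x) (a * y) = ENNReal.ofReal (a ^ (-1 : ℝ)) * k x y)
    {S T : Set ℝ} (hS : MeasurableSet S) (hS0 : S ⊆ Ioi 0) {x : ℝ} (hx : 0 < x)
    (hT : ∀ t ∈ S, x * t ∈ T) :
    ENNReal.ofReal (x ^ (-(1 / p))) * ∫⁻ t in S, k 1 t * ENNReal.ofReal (t ^ (-(1 / p))) ≤
      ∫⁻ y in Ioi (0 : ℝ), k x y * T.indicator (fun y => ENNReal.ofReal (y ^ (-(1 / p)))) y := by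
  have himage : (fun t => x * t) '' S ⊆ Ioi 0 := by
    rintro _ ⟨t, ht, rfl⟩
    exact mul_pos hx (hS0 ht)
  refine le_trans (le_of_eq ?_) (lintegral_mono_set himage)
  rw [lintegral_image_eq_lintegral_abs_deriv_mul (f' := fun _ => x) hS
    (fun t _ => by simpa using ((hasDerivAt_id t).const_mul x).hasDerivWithinAt)
    (mul_right_injective₀ hx.ne').injOn, ← lintegral_const_mul' _ _ ENNReal.ofReal_ne_top]
  refine setLIntegral_congr_fun hS fun t ht => ?_
  have ht0 : 0 < t := hS0 ht
  have hkt := hk_hom x 1 t hx one_pos ht0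
  rw [mul_one] at hkt
  have hcancel : ENNReal.ofReal |x| * ENNReal.ofReal (x ^ (-1 : ℝ)) = 1 := by
    rw [← ENNReal.ofReal_mul (abs_nonneg x), abs_of_pos hx, Real.rpow_neg_one,
      mul_inv_cancel₀ hx.ne', ENNReal.ofReal_one]
  simp only [indicator_of_mem (hT t ht), hkt]
  rw [Real.mul_rpow hx.le ht0.le, ENNReal.ofReal_mul (by positivity)]
  calc _ = 1 * (ENNReal.ofReal (x ^ (-(1 / p))) *
        (k 1 t * ENNReal.ofReal (t ^ (-(1 / p))))) := (one_mul _).symm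
    _ = _ := by rw [← hcancel]; ring

lemma iUnion_Ioc_exp_neg_exp :
    ⋃ n : ℕ, Ioc (Real.exp (-(n + 1 : ℝ))) (Real.exp (n + 1)) = Ioi 0 := by
  ext t
  simp only [mem_iUnion, mem_Ioi]
  constructor
  · rintro ⟨n, hn⟩
    exact (Real.exp_pos _).trans hn.1
  · intro ht
    obtain ⟨n, hn⟩ := exists_nat_gt |Real.log t|
    have hlog := abs_lt.1 hn
    refine ⟨n, (Real.lt_log_iff_exp_lt ht).1 ?_, (Real.log_le_iff_le_exp ht).1 ?_⟩ <;> linarith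

lemma monotone_Ioc_exp_neg_exp :
    Monotone fun n : ℕ => Ioc (Real.exp (-(n + 1 : ℝ))) (Real.exp (n + 1)) := by
  intro i j hij
  have hij' : (i : ℝ) ≤ j := by exact_mod_cast hij
  exact Ioc_subset_Ioc (Real.exp_le_exp.2 (by linarith)) (Real.exp_le_exp.2 (by linarith))

/-- Necessity/sharpness: if a kernel homogeneous of order `−1` satisfies the
Hardy-type inequality `∫₀^∞ (∫₀^∞ k(x,y) f(y) dy)^p dx ≤ C ∫₀^∞ f^p` for all
nonnegative measurable `f`, then `C_p* = ∫₀^∞ k(1,y) y^{−1/p} dy` is finite and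
`(C_p*)^p ≤ C`. -/
theorem stmt_6 (p q : ℝ) (hp : 1 < p) (hq : q = p / (p - 1))
    (k : ℝ → ℝ → ℝ≥0∞) (hk : Measurable (Function.uncurry k))
    (hk_hom : ∀ a x y : ℝ, 0 < a → 0 < x → 0 < y →
      k (a * x) (a * y) = ENNReal.ofReal (a ^ (-1 : ℝ)) * k x y)
    (C : ℝ≥0∞) (hC : C < ⊤)
    (h : ∀ f : ℝ → ℝ≥0∞, Measurable f →
      ∫⁻ x in Ioi (0 : ℝ), (∫⁻ y in Ioi (0 : ℝ), k x y * f y) ^ p ≤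
        C * ∫⁻ x in Ioi (0 : ℝ), f x ^ p) :
    (∫⁻ y in Ioi (0 : ℝ), k 1 y * ENNReal.ofReal (y ^ (-(1 / p)))) < ⊤ ∧
      (∫⁻ y in Ioi (0 : ℝ), k 1 y * ENNReal.ofReal (y ^ (-(1 / p)))) ^ p ≤ C := by
  have hp0 : 0 < p := one_pos.trans hp
  have htrunc (m : ℝ) (hm : 0 < m) :
      (∫⁻ y in Ioc (Real.exp (-m)) (Real.exp m), k 1 y * ENNReal.ofReal (y ^ (-(1 / p)))) ^ p
        ≤ C := by
    refine ENNReal.le_of_forall_nat_mul_le hm hC.ne fun n => ?_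
    set I := ∫⁻ y in Ioc (Real.exp (-m)) (Real.exp m), k 1 y * ENNReal.ofReal (y ^ (-(1 / p)))
    set T := Ioc (Real.exp 0) (Real.exp (m * (n + 2)))
    set f : ℝ → ℝ≥0∞ := T.indicator fun y => ENNReal.ofReal (y ^ (-(1 / p)))
    have hmn : 0 ≤ m * n := by positivity
    have hf : Measurable f := Measurable.indicator (by fun_prop) measurableSet_Ioc
    have hright : ∫⁻ x in Ioi (0 : ℝ), f x ^ p = ENNReal.ofReal (m * (n + 2)) := by
      have hfp : (fun x => f x ^ p) = T.indicator fun x => ENNReal.ofReal x⁻¹ := by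
        funext x
        by_cases hx : x ∈ T
        · simp only [f, indicator_of_mem hx]
          exact ofReal_rpow_neg_one_div_rpow hp0 ((Real.exp_pos 0).trans hx.1)
        · simp only [f, indicator_of_notMem hx, ENNReal.zero_rpow_of_pos hp0]
      have hT : T ⊆ Ioi 0 := fun x hx => (Real.exp_pos 0).trans hx.1
      rw [hfp, setLIntegral_indicator measurableSet_Ioc, inter_eq_left.2 hT,
        setLIntegral_Ioc_ofReal_inv (by positivity), sub_zero]
    have hleft : I ^ p * ENNReal.ofReal (m * n) ≤
        ∫⁻ x in Ioi (0 : ℝ), (∫⁻ y in Ioi (0 : ℝ), k x y * f y) ^ p := by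
      have hsub : Ioc (Real.exp m) (Real.exp (m * (n + 1))) ⊆ Ioi 0 :=
        fun x hx => (Real.exp_pos m).trans hx.1
      calc I ^ p * ENNReal.ofReal (m * n)
          = ∫⁻ x in Ioc (Real.exp m) (Real.exp (m * (n + 1))), I ^ p * ENNReal.ofReal x⁻¹ := by
            rw [lintegral_const_mul _ (by fun_prop), setLIntegral_Ioc_ofReal_inv (by linarith)]
            congr 2
            ring
        _ ≤ ∫⁻ x in Ioc (Real.exp m) (Real.exp (m * (n + 1))),
              (∫⁻ y in Ioi (0 : ℝ), k x y * f y) ^ p := by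
            refine setLIntegral_mono' measurableSet_Ioc fun x hx => ?_
            have hx0 : 0 < x := hsub hx
            rw [← ofReal_rpow_neg_one_div_rpow hp0 hx0, mul_comm,
              ← ENNReal.mul_rpow_of_nonneg _ _ hp0.le]
            refine ENNReal.rpow_le_rpow ?_ hp0.le
            refine rpow_mul_setLIntegral_le_of_homogeneous hk_hom measurableSet_Ioc
              (fun t ht => (Real.exp_pos _).trans ht.1) hx0 fun t ht => ⟨?_, ?_⟩
            · calc Real.exp 0 = Real.exp m * Real.exp (-m) := by rw [← Real.exp_add]; simp
                _ < x * t := mul_lt_mul'' hx.1 ht.1 (Real.exp_pos _).le (Real.exp_pos _).le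
            · calc x * t ≤ Real.exp (m * (n + 1)) * Real.exp m :=
                    mul_le_mul hx.2 ht.2 ((Real.exp_pos _).trans ht.1).le (Real.exp_pos _).le
                _ = Real.exp (m * (n + 2)) := by rw [← Real.exp_add]; ring_nf
        _ ≤ _ := lintegral_mono_set hsub
    exact hleft.trans ((h f hf).trans_eq (by rw [hright]))
  have hle : ∫⁻ y in Ioi (0 : ℝ), k 1 y * ENNReal.ofReal (y ^ (-(1 / p))) ≤ C ^ p⁻¹ := by
    rw [← iUnion_Ioc_exp_neg_exp,
      setLIntegral_iUnion_of_directed _ monotone_Ioc_exp_neg_exp.directed_le]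
    exact iSup_le fun n => (ENNReal.le_rpow_inv_iff hp0).2 (htrunc _ (by positivity))
  exact ⟨hle.trans_lt (ENNReal.rpow_lt_top_of_nonneg (inv_nonneg.2 hp0.le) hC.ne),
    (ENNReal.le_rpow_inv_iff hp0).1 hle⟩
end

section
/- Let p > 1 and let k be a nonnegative measurable kernel on (0,∞)×(0,∞) that is homogeneous of order λ (i.e. k(ax,ay) = a^λ k(x,y) for all x,y,a > 0) and is not almost everywhere equal to zero. If there exists a finite constant C such that ∫₀^∞ (∫₀^∞ k(x,y) f(y) dy)^p dx ≤ C ∫₀^∞ f(x)^p dx for all nonnegative measurable functions f on (0,∞), then λ = −1. -/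
open MeasureTheory Set ENNReal

theorem setLIntegral_Ioi_comp_mul_left (g : ℝ → ℝ≥0∞) {a : ℝ} (ha : 0 < a) :
    ∫⁻ x in Ioi (0 : ℝ), g x = ENNReal.ofReal a * ∫⁻ x in Ioi (0 : ℝ), g (a * x) := by
  have he : MeasurableEmbedding (fun x : ℝ => a * x) :=
    (Homeomorph.mulLeft₀ a ha.ne').measurableEmbedding
  have hpre : (fun x : ℝ => a * x) ⁻¹' Ioi 0 = Ioi 0 := by
    ext x
    simp [ha]
  have hmap := Real.smul_map_volume_mul_left ha.ne'
  rw [abs_of_pos ha] at hmap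
  conv_lhs => rw [← hmap]
  rw [Measure.restrict_smul, lintegral_smul_measure, smul_eq_mul,
    he.restrict_map, he.lintegral_map, hpre]

/-- If the kernel is not a.e. zero, its integral against a positive function is not a.e. zero. -/
theorem lintegral_rpow_lintegral_mul_ne_zero {α β : Type*} [MeasurableSpace α]
    [MeasurableSpace β] {μ : Measure α} {ν : Measure β} [SFinite ν]
    {p : ℝ} (hp : 0 < p) {k : α → β → ℝ≥0∞} (hk : Measurable (Function.uncurry k))
    (hk_ne : ¬ ∀ᵐ z ∂μ.prod ν, k z.1 z.2 = 0)
    {f : β → ℝ≥0∞} (hf : Measurable f) (hf_ne : ∀ y, f y ≠ 0) :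
    ∫⁻ x, (∫⁻ y, k x y * f y ∂ν) ^ p ∂μ ≠ 0 := by
  intro h0
  have hm : Measurable (fun z : α × β => k z.1 z.2 * f z.2) :=
    hk.mul (hf.comp measurable_snd)
  have hT : Measurable (fun x => ∫⁻ y, k x y * f y ∂ν) := hm.lintegral_prod_right'
  rw [lintegral_eq_zero_iff (hT.pow_const p)] at h0
  have h1 : ∫⁻ z, k z.1 z.2 * f z.2 ∂μ.prod ν = 0 := by
    rw [lintegral_prod _ hm.aemeasurable, lintegral_eq_zero_iff hT]
    filter_upwards [h0] with x hx
    simpa [ENNReal.rpow_eq_zero_iff, hp, hp.not_gt] using hx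
  rw [lintegral_eq_zero_iff hm] at h1
  apply hk_ne
  filter_upwards [h1] with z hz
  exact (mul_eq_zero.mp hz).resolve_right (hf_ne _)

/-- Dilating the test function by `a` in the `L^p` inequality for a homogeneous kernel. -/
theorem lintegral_rpow_le_rpow_mul_of_homogeneous {p l : ℝ} (hp : 0 < p)
    {k : ℝ → ℝ → ℝ≥0∞}
    (hk_hom : ∀ a x y : ℝ, 0 < a → 0 < x → 0 < y →
      k (a * x) (a * y) = ENNReal.ofReal (a ^ l) * k x y)
    {C : ℝ≥0∞} {f : ℝ → ℝ≥0∞} {a : ℝ} (ha : 0 < a)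
    (h : ∫⁻ x in Ioi (0 : ℝ), (∫⁻ y in Ioi (0 : ℝ), k x y * f (a * y)) ^ p ≤
        C * ∫⁻ x in Ioi (0 : ℝ), f (a * x) ^ p) :
    ∫⁻ x in Ioi (0 : ℝ), (∫⁻ y in Ioi (0 : ℝ), k x y * f y) ^ p ≤
      ENNReal.ofReal (a ^ ((l + 1) * p)) * (C * ∫⁻ x in Ioi (0 : ℝ), f x ^ p) := by
  have hinner : ∀ x ∈ Ioi (0 : ℝ), (∫⁻ y in Ioi (0 : ℝ), k (a * x) y * f y) ^ p =
      ENNReal.ofReal (a ^ ((l + 1) * p)) *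
        (∫⁻ y in Ioi (0 : ℝ), k x y * f (a * y)) ^ p := by
    intro x hx
    have hy : ∫⁻ y in Ioi (0 : ℝ), k (a * x) (a * y) * f (a * y) =
        ENNReal.ofReal (a ^ l) * ∫⁻ y in Ioi (0 : ℝ), k x y * f (a * y) := by
      rw [← lintegral_const_mul' _ _ ofReal_ne_top]
      refine setLIntegral_congr_fun measurableSet_Ioi fun y hy => ?_
      simp only [hk_hom a x y ha hx hy, mul_assoc]
    rw [setLIntegral_Ioi_comp_mul_left _ ha, hy, ← mul_assoc, ← ofReal_mul ha.le,
      ENNReal.mul_rpow_of_nonneg _ _ hp.le, ofReal_rpow_of_pos (by positivity),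
      Real.rpow_mul ha.le, Real.rpow_add ha, Real.rpow_one, mul_comm a]
  rw [setLIntegral_Ioi_comp_mul_left (fun x => f x ^ p) ha,
    setLIntegral_Ioi_comp_mul_left _ ha,
    setLIntegral_congr_fun measurableSet_Ioi hinner, lintegral_const_mul' _ _ ofReal_ne_top]
  calc _ ≤ ENNReal.ofReal a * (ENNReal.ofReal (a ^ ((l + 1) * p)) *
        (C * ∫⁻ x in Ioi (0 : ℝ), f (a * x) ^ p)) := by gcongr
    _ = _ := by ring

/-- Dilation argument: if a kernel on `(0,∞)×(0,∞)`, homogeneous of order `λ`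
and not a.e. zero, satisfies an `L^p → L^p` Hardy-type inequality with some
finite constant, then necessarily `λ = −1`. -/
theorem stmt_7 (p l : ℝ) (hp : 1 < p)
    (k : ℝ → ℝ → ℝ≥0∞) (hk : Measurable (Function.uncurry k))
    (hk_hom : ∀ a x y : ℝ, 0 < a → 0 < x → 0 < y →
      k (a * x) (a * y) = ENNReal.ofReal (a ^ l) * k x y)
    (hk_ne : ¬ (∀ᵐ z ∂((volume.restrict (Ioi (0 : ℝ))).prod
        (volume.restrict (Ioi (0 : ℝ)))), k z.1 z.2 = 0))
    (C : ℝ≥0∞) (hC : C < ⊤)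
    (h : ∀ f : ℝ → ℝ≥0∞, Measurable f →
      ∫⁻ x in Ioi (0 : ℝ), (∫⁻ y in Ioi (0 : ℝ), k x y * f y) ^ p ≤
        C * ∫⁻ x in Ioi (0 : ℝ), f x ^ p) :
    l = -1 := by
  have hp0 : 0 < p := one_pos.trans hp
  by_contra hl
  have hs : (l + 1) * p ≠ 0 := mul_ne_zero (fun h0 => hl (by linarith)) hp0.ne'
  set f : ℝ → ℝ≥0∞ := fun y => ENNReal.ofReal (Real.exp (-y))
  have hf : Measurable f := by fun_prop
  have hA := lintegral_rpow_lintegral_mul_ne_zero hp0 hk hk_ne hf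
    (fun y => (ofReal_pos.mpr (Real.exp_pos _)).ne')
  have hN : ∫⁻ x in Ioi (0 : ℝ), f x ^ p ≠ ⊤ := by
    have hfp : ∀ x, f x ^ p = ENNReal.ofReal (Real.exp (-p * x)) := fun x => by
      rw [ofReal_rpow_of_pos (Real.exp_pos _), ← Real.exp_mul]
      ring_nf
    simp only [hfp]
    exact (exp_neg_integrableOn_Ioi 0 hp0).lintegral_lt_top.ne
  have hM : C * ∫⁻ x in Ioi (0 : ℝ), f x ^ p ≠ ⊤ := mul_ne_top hC.ne hN
  have key : ∀ t : ℝ, 0 < t →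
      ∫⁻ x in Ioi (0 : ℝ), (∫⁻ y in Ioi (0 : ℝ), k x y * f y) ^ p ≤
        ENNReal.ofReal t * (C * ∫⁻ x in Ioi (0 : ℝ), f x ^ p) := by
    intro t ht
    have := lintegral_rpow_le_rpow_mul_of_homogeneous hp0 hk_hom
      (Real.rpow_pos_of_pos ht ((l + 1) * p)⁻¹) (h _ (hf.comp (measurable_const_mul _)))
    rwa [Real.rpow_inv_rpow ht.le hs] at this
  have hlim : Filter.Tendsto
      (fun t : ℝ => ENNReal.ofReal t * (C * ∫⁻ x in Ioi (0 : ℝ), f x ^ p))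
      (nhdsWithin 0 (Ioi 0)) (nhds 0) := by
    simpa using ENNReal.Tendsto.mul_const
      ((ENNReal.continuous_ofReal.tendsto 0).mono_left nhdsWithin_le_nhds) (Or.inr hM)
  exact hA (nonpos_iff_eq_zero.mp
    (ge_of_tendsto hlim (eventually_mem_nhdsWithin.mono key)))
end

section
/- Let p > 1, 1/p + 1/q = 1, and let k be a nonnegative measurable function on (0,∞)×(0,∞) with k(ar,as) = a^{−1} k(r,s) for all r,s,a > 0, and set C_p* := 2 ∫₀^∞ k(1,s) s^{−1/p} ds. Then the inequality (∫_ℝ (∫_ℝ k(|x|,|y|) f(y) dy)^p dx)^{1/p} ≤ C (∫_ℝ f(x)^p dx)^{1/p} holds for some finite constant C and all nonnegative measurable functions f on ℝ if and only if C_p* < ∞; moreover, when C_p* < ∞ the inequality holds with C = C_p*, and C_p* is the smallest such constant. -/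
open MeasureTheory Set ENNReal

open Filter Topology

theorem lintegral_comp_abs (g : ℝ → ℝ≥0∞) :
    ∫⁻ x : ℝ, g |x| = 2 * ∫⁻ x in Ioi (0 : ℝ), g x := by
  have h_pos : ∫⁻ x in Ioi (0 : ℝ), g |x| = ∫⁻ x in Ioi (0 : ℝ), g x :=
    setLIntegral_congr_fun measurableSet_Ioi fun x hx => by rw [abs_of_pos hx]
  have h_neg : ∫⁻ x in Iio (0 : ℝ), g |x| = ∫⁻ x in Ioi (0 : ℝ), g x := by
    have h := lintegral_image_eq_lintegral_abs_deriv_mul (s := Ioi (0 : ℝ)) (f := Neg.neg)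
      (f' := fun _ => -1) measurableSet_Ioi
      (fun x _ => (hasDerivAt_neg x).hasDerivWithinAt) neg_injective.injOn (fun x => g |x|)
    simpa [h_pos] using h
  rw [← lintegral_add_compl _ (measurableSet_Ioi (a := (0 : ℝ))), h_pos, compl_Ioi,
    setLIntegral_congr Iio_ae_eq_Iic.symm, h_neg, two_mul]

theorem lintegral_Ioi_eq_mul_lintegral_comp_mul {x : ℝ} (hx : 0 < x) (h : ℝ → ℝ≥0∞) :
    ∫⁻ y in Ioi (0 : ℝ), h y = ∫⁻ s in Ioi (0 : ℝ), ENNReal.ofReal x * h (x * s) := by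
  have h_image : (fun s => x * s) '' Ioi (0 : ℝ) = Ioi 0 := by
    simpa using image_const_mul_Ioi_zero hx
  have hx' := lintegral_image_eq_lintegral_abs_deriv_mul (s := Ioi (0 : ℝ))
    (f := fun s => x * s) (f' := fun _ => x) measurableSet_Ioi
    (fun s _ => by simpa using ((hasDerivAt_id s).const_mul x).hasDerivWithinAt)
    (mul_right_injective₀ hx.ne').injOn h
  rwa [h_image, abs_of_pos hx] at hx'

theorem lintegral_Ioi_eq_lintegral_comp_div {y : ℝ} (hy : 0 < y) (h : ℝ → ℝ≥0∞) :
    ∫⁻ x in Ioi (0 : ℝ), h x =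
      ∫⁻ s in Ioi (0 : ℝ), ENNReal.ofReal (y / s ^ 2) * h (y / s) := by
  have h_image : (fun s => y / s) '' Ioi (0 : ℝ) = Ioi 0 := by
    ext t
    constructor
    · rintro ⟨s, hs, rfl⟩
      exact div_pos hy hs
    · intro ht
      exact ⟨y / t, div_pos hy ht, div_div_cancel₀ hy.ne'⟩
  have hy' := lintegral_image_eq_lintegral_abs_deriv_mul (s := Ioi (0 : ℝ))
    (f := fun s => y / s) (f' := fun s => -y / s ^ 2) measurableSet_Ioi
    (fun s hs => by
      simpa [div_eq_mul_inv] using ((hasDerivAt_inv (ne_of_gt hs)).const_mul y).hasDerivWithinAt)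
    (fun s hs t ht hst => by
      have hs' : s ≠ 0 := ne_of_gt hs
      have ht' : t ≠ 0 := ne_of_gt ht
      field_simp at hst
      exact hst.symm) h
  rw [h_image] at hy'
  rw [hy']
  refine setLIntegral_congr_fun measurableSet_Ioi fun s _ => ?_
  simp only [abs_div, abs_neg, abs_of_pos hy, abs_of_nonneg (sq_nonneg s)]

theorem lintegral_Ioi_rpow {a c : ℝ} (ha : 0 < a) (hc : 0 < c) :
    ∫⁻ x in Ioi c, ENNReal.ofReal (x ^ (-1 - a)) = ENNReal.ofReal (c ^ (-a) / a) := by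
  rw [← ofReal_integral_eq_lintegral_ofReal (integrableOn_Ioi_rpow_of_lt (by linarith) hc),
    integral_Ioi_rpow_of_lt (by linarith) hc]
  · congr 1
    rw [show -1 - a + 1 = -a by ring, neg_div_neg_eq]
  · filter_upwards [ae_restrict_mem measurableSet_Ioi] with x hx
    exact Real.rpow_nonneg (hc.le.trans (le_of_lt hx)) _

theorem lintegral_indicator_Ioi_abs {c : ℝ} (hc : 0 < c) (g : ℝ → ℝ≥0∞) :
    ∫⁻ x : ℝ, (Ioi c).indicator g |x| = 2 * ∫⁻ x in Ioi c, g x := by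
  rw [lintegral_comp_abs, lintegral_indicator measurableSet_Ioi,
    Measure.restrict_restrict measurableSet_Ioi, Ioi_inter_Ioi, sup_of_le_left hc.le]

theorem lintegral_Ioi_le_of_forall_Ioc_le {g : ℝ → ℝ≥0∞} {B : ℝ≥0∞}
    (h : ∀ N : ℝ, 1 < N → ∫⁻ s in Ioc N⁻¹ N, g s ≤ B) : ∫⁻ s in Ioi (0 : ℝ), g s ≤ B := by
  have h_mono : Monotone fun n : ℕ => Ioc ((n : ℝ) + 2)⁻¹ ((n : ℝ) + 2) := by
    intro m n hmn
    have : (m : ℝ) ≤ n := Nat.cast_le.2 hmn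
    exact Ioc_subset_Ioc (by gcongr) (by gcongr)
  have h_union : ⋃ n : ℕ, Ioc ((n : ℝ) + 2)⁻¹ ((n : ℝ) + 2) = Ioi 0 := by
    ext s
    simp only [mem_iUnion, mem_Ioc, mem_Ioi]
    constructor
    · rintro ⟨n, hn, -⟩
      exact lt_trans (by positivity) hn
    · intro hs
      obtain ⟨n, hn⟩ := exists_nat_gt (max s s⁻¹)
      refine ⟨n, ?_, by linarith [le_max_left s s⁻¹]⟩
      rw [inv_lt_comm₀ (by positivity) hs]
      linarith [le_max_right s s⁻¹]
  rw [← h_union, setLIntegral_iUnion_of_directed _ h_mono.directed_le]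
  exact iSup_le fun n => h _ (by linarith [(n.cast_nonneg : (0 : ℝ) ≤ n)])

section HomogeneousKernel

variable {k : ℝ → ℝ → ℝ≥0∞}
  (hk_hom : ∀ a r s : ℝ, 0 < a → 0 < r → 0 < s →
    k (a * r) (a * s) = ENNReal.ofReal (a ^ (-1 : ℝ)) * k r s)

include hk_hom

theorem lintegral_homogeneous_left {x : ℝ} (hx : 0 < x) (g : ℝ → ℝ≥0∞) :
    ∫⁻ y in Ioi (0 : ℝ), k x y * g y = ∫⁻ s in Ioi (0 : ℝ), k 1 s * g (x * s) := by
  rw [lintegral_Ioi_eq_mul_lintegral_comp_mul hx]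
  refine setLIntegral_congr_fun measurableSet_Ioi fun s hs => ?_
  have h := hk_hom x 1 s hx one_pos hs
  rw [mul_one] at h
  simp only [h]
  rw [← mul_assoc, ← mul_assoc, ← ENNReal.ofReal_mul hx.le, Real.rpow_neg_one,
    mul_inv_cancel₀ hx.ne', ENNReal.ofReal_one, one_mul]

theorem lintegral_homogeneous_right {y : ℝ} (hy : 0 < y) (g : ℝ → ℝ≥0∞) :
    ∫⁻ x in Ioi (0 : ℝ), k x y * g x =
      ∫⁻ s in Ioi (0 : ℝ), k 1 s * (ENNReal.ofReal s⁻¹ * g (y / s)) := by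
  rw [lintegral_Ioi_eq_lintegral_comp_div hy]
  refine setLIntegral_congr_fun measurableSet_Ioi fun s (hs : 0 < s) => ?_
  have h := hk_hom (y / s) 1 s (div_pos hy hs) one_pos hs
  rw [mul_one, div_mul_cancel₀ _ hs.ne'] at h
  simp only [h]
  rw [← mul_assoc, ← mul_assoc, ← ENNReal.ofReal_mul (by positivity), Real.rpow_neg_one,
    show y / s ^ 2 * (y / s)⁻¹ = s⁻¹ by field_simp]
  ring

theorem lintegral_homogeneous_mul_rpow_left {x : ℝ} (hx : x ≠ 0) (p : ℝ) :
    ∫⁻ y : ℝ, k |x| |y| * ENNReal.ofReal (|y| ^ (-(1 / p))) =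
      ENNReal.ofReal (|x| ^ (-(1 / p))) *
        (2 * ∫⁻ s in Ioi (0 : ℝ), k 1 s * ENNReal.ofReal (s ^ (-(1 / p)))) := by
  rw [lintegral_comp_abs (fun y => k |x| y * ENNReal.ofReal (y ^ (-(1 / p)))),
    lintegral_homogeneous_left hk_hom (abs_pos.2 hx) (fun y => ENNReal.ofReal (y ^ (-(1 / p)))),
    mul_left_comm, ← lintegral_const_mul' _ _ ENNReal.ofReal_ne_top]
  congr 1
  refine setLIntegral_congr_fun measurableSet_Ioi fun s (hs : 0 < s) => ?_
  rw [Real.mul_rpow (abs_nonneg x) hs.le, ENNReal.ofReal_mul (by positivity), mul_left_comm]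

theorem lintegral_homogeneous_mul_rpow_right {p q : ℝ} (hpq : 1 / p + 1 / q = 1) {y : ℝ}
    (hy : y ≠ 0) :
    ∫⁻ x : ℝ, k |x| |y| * ENNReal.ofReal (|x| ^ (-(1 / q))) =
      ENNReal.ofReal (|y| ^ (-(1 / q))) *
        (2 * ∫⁻ s in Ioi (0 : ℝ), k 1 s * ENNReal.ofReal (s ^ (-(1 / p)))) := by
  rw [lintegral_comp_abs (fun x => k x |y| * ENNReal.ofReal (x ^ (-(1 / q)))),
    lintegral_homogeneous_right hk_hom (abs_pos.2 hy) (fun x => ENNReal.ofReal (x ^ (-(1 / q)))),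
    mul_left_comm, ← lintegral_const_mul' _ _ ENNReal.ofReal_ne_top]
  congr 1
  refine setLIntegral_congr_fun measurableSet_Ioi fun s (hs : 0 < s) => ?_
  have h_rpow : s⁻¹ * (|y| ^ (-(1 / q)) / s ^ (-(1 / q))) =
      |y| ^ (-(1 / q)) * s ^ (-(1 / p)) := by
    rw [show -(1 / p) = -1 - -(1 / q) by linarith, Real.rpow_sub hs, Real.rpow_neg_one]
    ring
  rw [Real.div_rpow (abs_nonneg y) hs.le, ← ENNReal.ofReal_mul (by positivity), h_rpow,
    ENNReal.ofReal_mul (by positivity), mul_left_comm]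

theorem lintegral_homogeneous_rpow_le {p q : ℝ} (hpq : p.HolderConjugate q)
    (hk : Measurable (Function.uncurry k)) {C : ℝ≥0∞}
    (hC : C = 2 * ∫⁻ s in Ioi (0 : ℝ), k 1 s * ENNReal.ofReal (s ^ (-(1 / p))))
    {f : ℝ → ℝ≥0∞} (hf : Measurable f) :
    ∫⁻ x : ℝ, (∫⁻ y : ℝ, k |x| |y| * f y) ^ p ≤ C ^ p * ∫⁻ x : ℝ, f x ^ p := by
  have hp : 0 < p := hpq.pos
  have hq : 0 < q := hpq.symm.pos
  have hpq_inv : 1 / p + 1 / q = 1 := by simpa using hpq.inv_add_inv_eq_one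
  have hk_abs : Measurable (Function.uncurry fun x y : ℝ => k |x| |y|) :=
    hk.comp (f := fun z : ℝ × ℝ => (|z.1|, |z.2|)) (by fun_prop)
  have hk_row (x : ℝ) : Measurable fun y : ℝ => k |x| |y| := hk_abs.of_uncurry_left
  have hk_col (y : ℝ) : Measurable fun x : ℝ => k |x| |y| := hk_abs.of_uncurry_right
  have h_ne : ∀ᵐ x : ℝ, x ≠ 0 := by simp [ae_iff]
  have h_holder : ∀ᵐ x : ℝ, (∫⁻ y : ℝ, k |x| |y| * f y) ^ p ≤
      C ^ (p / q) * ∫⁻ y : ℝ, ENNReal.ofReal (|x| ^ (-(1 / q))) *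
        (k |x| |y| * (ENNReal.ofReal (|y| ^ (1 / q)) * f y ^ p)) := by
    filter_upwards [h_ne] with x hx
    have hx' : 0 < |x| := abs_pos.2 hx
    have h_split : ∫⁻ y : ℝ, k |x| |y| * f y =
        ∫⁻ y : ℝ, ((fun y => k |x| |y| ^ (1 / p) *
            (ENNReal.ofReal (|y| ^ (1 / (p * q))) * f y)) *
          (fun y => k |x| |y| ^ (1 / q) * ENNReal.ofReal (|y| ^ (-(1 / (p * q)))))) y := by
      refine lintegral_congr_ae ?_
      filter_upwards [h_ne] with y hy
      have hy' : 0 < |y| := abs_pos.2 hy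
      have h_one : ENNReal.ofReal (|y| ^ (1 / (p * q))) *
          ENNReal.ofReal (|y| ^ (-(1 / (p * q)))) = 1 := by
        rw [← ENNReal.ofReal_mul (by positivity), ← Real.rpow_add hy', add_neg_cancel,
          Real.rpow_zero, ENNReal.ofReal_one]
      have h_k : k |x| |y| ^ (1 / p) * k |x| |y| ^ (1 / q) = k |x| |y| := by
        rw [← ENNReal.rpow_add_of_nonneg _ _ (by positivity) (by positivity), hpq_inv,
          ENNReal.rpow_one]
      calc k |x| |y| * f y
          = (k |x| |y| ^ (1 / p) * k |x| |y| ^ (1 / q)) * (ENNReal.ofReal (|y| ^ (1 / (p * q))) *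
              ENNReal.ofReal (|y| ^ (-(1 / (p * q))))) * f y := by rw [h_k, h_one, mul_one]
        _ = _ := by simp only [Pi.mul_apply]; ring
    have h_left (y : ℝ) : (k |x| |y| ^ (1 / p) *
        (ENNReal.ofReal (|y| ^ (1 / (p * q))) * f y)) ^ p =
        k |x| |y| * (ENNReal.ofReal (|y| ^ (1 / q)) * f y ^ p) := by
      rw [ENNReal.mul_rpow_of_nonneg _ _ hp.le, ENNReal.mul_rpow_of_nonneg _ _ hp.le,
        ← ENNReal.rpow_mul, one_div_mul_cancel hp.ne', ENNReal.rpow_one,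
        ENNReal.ofReal_rpow_of_nonneg (by positivity) hp.le, ← Real.rpow_mul (abs_nonneg y),
        show 1 / (p * q) * p = 1 / q by field_simp]
    have h_right (y : ℝ) : (k |x| |y| ^ (1 / q) *
        ENNReal.ofReal (|y| ^ (-(1 / (p * q))))) ^ q =
        k |x| |y| * ENNReal.ofReal (|y| ^ (-(1 / p))) := by
      rw [ENNReal.mul_rpow_of_nonneg _ _ hq.le,
        ← ENNReal.rpow_mul, one_div_mul_cancel hq.ne', ENNReal.rpow_one,
        ENNReal.ofReal_rpow_of_nonneg (by positivity) hq.le, ← Real.rpow_mul (abs_nonneg y),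
        show -(1 / (p * q)) * q = -(1 / p) by field_simp]
    rw [h_split]
    calc _ ≤ _ := ENNReal.rpow_le_rpow (ENNReal.lintegral_mul_le_Lp_mul_Lq volume hpq
          (by have := hk_row x; fun_prop) (by have := hk_row x; fun_prop)) hp.le
      _ = _ := by
        simp only [h_left, h_right]
        rw [lintegral_homogeneous_mul_rpow_left hk_hom hx, ← hC,
          ENNReal.mul_rpow_of_nonneg _ _ hp.le, ← ENNReal.rpow_mul, one_div_mul_cancel hp.ne',
          ENNReal.rpow_one, ← ENNReal.rpow_mul, ENNReal.mul_rpow_of_nonneg _ _ (by positivity),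
          ENNReal.ofReal_rpow_of_nonneg (by positivity) (by positivity),
          ← Real.rpow_mul (abs_nonneg x), lintegral_const_mul' _ _ ENNReal.ofReal_ne_top,
          show -(1 / p) * (1 / q * p) = -(1 / q) by field_simp,
          show 1 / q * p = p / q by ring]
        ring
  have h_swap : ∫⁻ x : ℝ, ∫⁻ y : ℝ, ENNReal.ofReal (|x| ^ (-(1 / q))) *
        (k |x| |y| * (ENNReal.ofReal (|y| ^ (1 / q)) * f y ^ p)) = C * ∫⁻ y : ℝ, f y ^ p := by
    rw [lintegral_lintegral_swap (by
      have := hk_abs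
      simp only [Function.uncurry_def] at this ⊢
      fun_prop), ← lintegral_const_mul _ (by fun_prop)]
    refine lintegral_congr_ae ?_
    filter_upwards [h_ne] with y hy
    have hy' : 0 < |y| := abs_pos.2 hy
    calc _ = ∫⁻ x : ℝ, (k |x| |y| * ENNReal.ofReal (|x| ^ (-(1 / q)))) *
          (ENNReal.ofReal (|y| ^ (1 / q)) * f y ^ p) := by
          refine lintegral_congr fun x => ?_
          ring
      _ = (ENNReal.ofReal (|y| ^ (-(1 / q))) * ENNReal.ofReal (|y| ^ (1 / q))) *
          (C * f y ^ p) := by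
        rw [lintegral_mul_const _ (by have := hk_col y; fun_prop),
          lintegral_homogeneous_mul_rpow_right hk_hom hpq_inv hy, ← hC]
        ring
      _ = C * f y ^ p := by
        rw [← ENNReal.ofReal_mul (by positivity), ← Real.rpow_add hy', neg_add_cancel,
          Real.rpow_zero, ENNReal.ofReal_one, one_mul]
  have h_meas : Measurable fun x : ℝ => ∫⁻ y : ℝ, ENNReal.ofReal (|x| ^ (-(1 / q))) *
      (k |x| |y| * (ENNReal.ofReal (|y| ^ (1 / q)) * f y ^ p)) :=
    Measurable.lintegral_prod_right' (f := fun z : ℝ × ℝ => ENNReal.ofReal (|z.1| ^ (-(1 / q))) *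
      (k |z.1| |z.2| * (ENNReal.ofReal (|z.2| ^ (1 / q)) * f z.2 ^ p))) (by
      have := hk_abs
      simp only [Function.uncurry_def] at this
      fun_prop)
  refine (lintegral_mono_ae h_holder).trans_eq ?_
  rw [lintegral_const_mul _ h_meas, h_swap, ← mul_assoc]
  congr 1
  nth_rewrite 2 [← ENNReal.rpow_one C]
  rw [← ENNReal.rpow_add_of_nonneg _ _ (by positivity) zero_le_one]
  congr 1
  field_simp at hpq_inv ⊢
  linarith

theorem lintegral_Ioc_le_of_hardy {p : ℝ} (hp : 0 < p) {C : ℝ≥0∞}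
    (hC : ∀ f : ℝ → ℝ≥0∞, Measurable f →
      (∫⁻ x : ℝ, (∫⁻ y : ℝ, k |x| |y| * f y) ^ p) ^ (1 / p) ≤
        C * (∫⁻ x : ℝ, f x ^ p) ^ (1 / p)) {N ε : ℝ} (hN : 1 < N) (hε : 0 < ε) :
    ENNReal.ofReal (N ^ (-(2 * ε))) *
      (2 * ∫⁻ s in Ioc N⁻¹ N, k 1 s * ENNReal.ofReal (s ^ (-(1 / p)))) ≤ C := by
  have hN₀ : 0 < N := one_pos.trans hN
  set S := 2 * ∫⁻ s in Ioc N⁻¹ N, k 1 s * ENNReal.ofReal (s ^ (-(1 / p))) with hS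
  set g : ℝ → ℝ≥0∞ := fun y => ENNReal.ofReal (y ^ (-(1 / p) - ε)) with hg
  have h_rpow {y : ℝ} (hy : 0 < y) : g y ^ p = ENNReal.ofReal (y ^ (-1 - ε * p)) := by
    rw [hg, ENNReal.ofReal_rpow_of_nonneg (by positivity) hp.le, ← Real.rpow_mul hy.le]
    congr 2
    field_simp
  have h_norm {c : ℝ} (hc : 0 < c) : ∫⁻ x : ℝ, (Ioi c).indicator g |x| ^ p =
      2 * ENNReal.ofReal (c ^ (-(ε * p)) / (ε * p)) := by
    have h_ind (x : ℝ) : (Ioi c).indicator g |x| ^ p =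
        (Ioi c).indicator (fun y => g y ^ p) |x| := by
      by_cases hx : |x| ∈ Ioi c <;> simp [hx, hp]
    simp_rw [h_ind]
    rw [lintegral_indicator_Ioi_abs hc, ← lintegral_Ioi_rpow (mul_pos hε hp) hc]
    congr 1
    exact setLIntegral_congr_fun measurableSet_Ioi fun y hy => h_rpow (hc.trans hy)
  have h_lower (x : ℝ) : (Ioi N).indicator g |x| * (ENNReal.ofReal (N ^ (-ε)) * S) ≤
      ∫⁻ y : ℝ, k |x| |y| * (Ioi 1).indicator g |y| := by
    by_cases hx : |x| ∈ Ioi N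
    swap
    · simp [hx]
    have hx' : N < |x| := hx
    have hx₀ : 0 < |x| := hN₀.trans hx'
    rw [lintegral_comp_abs (fun y => k |x| y * (Ioi 1).indicator g y),
      lintegral_homogeneous_left hk_hom hx₀, indicator_of_mem hx, hS,
      show ∀ a b c : ℝ≥0∞, a * (b * (2 * c)) = 2 * (c * (a * b)) by intros; ring,
      ← lintegral_mul_const' _ _ (ENNReal.mul_ne_top ENNReal.ofReal_ne_top ENNReal.ofReal_ne_top)]
    refine mul_le_mul' le_rfl ?_
    calc _ ≤ ∫⁻ s in Ioc N⁻¹ N, k 1 s * (Ioi 1).indicator g (|x| * s) := by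
          refine setLIntegral_mono' measurableSet_Ioc fun s hs => ?_
          have hs₀ : 0 < s := (inv_pos.2 hN₀).trans hs.1
          have h_mem : |x| * s ∈ Ioi 1 := by
            have := mul_lt_mul'' hx' hs.1 hN₀.le (inv_pos.2 hN₀).le
            rwa [mul_inv_cancel₀ hN₀.ne'] at this
          rw [indicator_of_mem h_mem, mul_assoc]
          gcongr
          simp only [hg]
          rw [← ENNReal.ofReal_mul (by positivity), ← ENNReal.ofReal_mul (by positivity),
            Real.mul_rpow hx₀.le hs₀.le, mul_left_comm]
          refine ENNReal.ofReal_le_ofReal (mul_le_mul_of_nonneg_left ?_ (by positivity))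
          rw [sub_eq_add_neg, Real.rpow_add hs₀]
          exact mul_le_mul_of_nonneg_left
            (Real.rpow_le_rpow_of_nonpos hs₀ hs.2 (by linarith)) (by positivity)
      _ ≤ _ := lintegral_mono_set fun s hs => (inv_pos.2 hN₀).trans hs.1
  have hg_meas : Measurable fun x : ℝ => (Ioi 1).indicator g |x| :=
    ((by fun_prop : Measurable g).indicator measurableSet_Ioi).comp (by fun_prop)
  have hgN_meas : Measurable fun x : ℝ => (Ioi N).indicator g |x| ^ p :=
    (((by fun_prop : Measurable g).indicator measurableSet_Ioi).comp
      (by fun_prop : Measurable fun x : ℝ => |x|)).pow_const p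
  set A := (2 * ENNReal.ofReal (1 / (ε * p))) ^ (1 / p) with hA
  have hA₀ : A ≠ 0 := by
    rw [hA, Ne, ENNReal.rpow_eq_zero_iff_of_pos (by positivity)]
    simp [hε, hp]
  have hA_top : A ≠ ⊤ :=
    ENNReal.rpow_ne_top_of_nonneg (by positivity)
      (ENNReal.mul_ne_top ENNReal.ofNat_ne_top ENNReal.ofReal_ne_top)
  have h_main := hC _ hg_meas
  rw [h_norm one_pos, Real.one_rpow, ← hA] at h_main
  rw [← ENNReal.mul_le_mul_iff_left hA₀ hA_top]
  refine le_trans (le_of_eq ?_) ((ENNReal.rpow_le_rpow (lintegral_mono fun x =>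
    ENNReal.rpow_le_rpow (h_lower x) hp.le) (by positivity)).trans h_main)
  have h_int : ∫⁻ x : ℝ, ((Ioi N).indicator g |x| * (ENNReal.ofReal (N ^ (-ε)) * S)) ^ p =
      2 * ENNReal.ofReal (N ^ (-(ε * p)) / (ε * p)) * (ENNReal.ofReal (N ^ (-ε)) * S) ^ p := by
    rw [← h_norm hN₀, ← lintegral_mul_const _ hgN_meas]
    exact lintegral_congr fun x => ENNReal.mul_rpow_of_nonneg _ _ hp.le
  rw [h_int, ENNReal.mul_rpow_of_nonneg _ _ (by positivity), ← ENNReal.rpow_mul,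
    mul_one_div_cancel hp.ne', ENNReal.rpow_one, div_eq_mul_one_div,
    ENNReal.ofReal_mul (by positivity), mul_left_comm 2 (ENNReal.ofReal (N ^ (-(ε * p)))),
    ENNReal.mul_rpow_of_nonneg _ _ (by positivity), ← hA,
    ENNReal.ofReal_rpow_of_nonneg (by positivity) (by positivity), ← Real.rpow_mul hN₀.le,
    show -(ε * p) * (1 / p) = -ε by field_simp, show -(2 * ε) = -ε + -ε by ring,
    Real.rpow_add hN₀, ENNReal.ofReal_mul (by positivity)]
  ring

theorem le_of_hardy {p : ℝ} (hp : 0 < p) {C : ℝ≥0∞}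
    (hC : ∀ f : ℝ → ℝ≥0∞, Measurable f →
      (∫⁻ x : ℝ, (∫⁻ y : ℝ, k |x| |y| * f y) ^ p) ^ (1 / p) ≤
        C * (∫⁻ x : ℝ, f x ^ p) ^ (1 / p)) :
    2 * ∫⁻ s in Ioi (0 : ℝ), k 1 s * ENNReal.ofReal (s ^ (-(1 / p))) ≤ C := by
  rw [← lintegral_const_mul' _ _ ENNReal.ofNat_ne_top]
  refine lintegral_Ioi_le_of_forall_Ioc_le fun N hN => ?_
  rw [lintegral_const_mul' _ _ ENNReal.ofNat_ne_top]
  set S := 2 * ∫⁻ s in Ioc N⁻¹ N, k 1 s * ENNReal.ofReal (s ^ (-(1 / p)))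
  have h_cont : Continuous fun ε : ℝ => ENNReal.ofReal (N ^ (-(2 * ε))) :=
    ENNReal.continuous_ofReal.comp
      (Continuous.rpow continuous_const (by fun_prop) fun _ => Or.inl (by linarith))
  have h_lim : Tendsto (fun ε : ℝ => ENNReal.ofReal (N ^ (-(2 * ε)))) (𝓝[>] 0) (𝓝 1) := by
    simpa using (h_cont.tendsto 0).mono_left nhdsWithin_le_nhds
  have h_lim' := ENNReal.Tendsto.mul_const (b := S) h_lim (Or.inl one_ne_zero)
  rw [one_mul] at h_lim'
  refine le_of_tendsto h_lim' ?_
  filter_upwards [self_mem_nhdsWithin] with ε hε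
  exact lintegral_Ioc_le_of_hardy hk_hom hp hC hN hε

end HomogeneousKernel

/-- For a radial kernel on `ℝ` homogeneous of order `−1`, with
`C_p* = 2∫₀^∞ k(1,s) s^{−1/p} ds`: the Hardy-type inequality
`(∫_ℝ (∫_ℝ k(|x|,|y|) f(y) dy)^p dx)^{1/p} ≤ C (∫_ℝ f^p)^{1/p}` holds for some
finite constant `C` iff `C_p* < ∞`; in that case it holds with `C = C_p*`, which
is the smallest such constant. -/
theorem stmt_18 (p q : ℝ) (hp : 1 < p) (hpq : 1 / p + 1 / q = 1)
    (k : ℝ → ℝ → ℝ≥0∞) (hk : Measurable (Function.uncurry k))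
    (hk_hom : ∀ a r s : ℝ, 0 < a → 0 < r → 0 < s →
      k (a * r) (a * s) = ENNReal.ofReal (a ^ (-1 : ℝ)) * k r s)
    (Cp : ℝ≥0∞)
    (hCp : Cp = 2 * ∫⁻ s in Ioi (0 : ℝ), k 1 s * ENNReal.ofReal (s ^ (-(1 / p)))) :
    ((∃ C : ℝ≥0∞, C < ⊤ ∧
        ∀ f : ℝ → ℝ≥0∞, Measurable f →
          (∫⁻ x : ℝ, (∫⁻ y : ℝ, k |x| |y| * f y) ^ p) ^ (1 / p) ≤
            C * (∫⁻ x : ℝ, f x ^ p) ^ (1 / p)) ↔ Cp < ⊤) ∧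
    (Cp < ⊤ →
      ∀ f : ℝ → ℝ≥0∞, Measurable f →
        (∫⁻ x : ℝ, (∫⁻ y : ℝ, k |x| |y| * f y) ^ p) ^ (1 / p) ≤
          Cp * (∫⁻ x : ℝ, f x ^ p) ^ (1 / p)) ∧
    (∀ C : ℝ≥0∞,
      (∀ f : ℝ → ℝ≥0∞, Measurable f →
        (∫⁻ x : ℝ, (∫⁻ y : ℝ, k |x| |y| * f y) ^ p) ^ (1 / p) ≤
          C * (∫⁻ x : ℝ, f x ^ p) ^ (1 / p)) → Cp ≤ C) := by
  subst hCp
  have hp₀ : 0 < p := one_pos.trans hp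
  have hpq' : p.HolderConjugate q := Real.holderConjugate_iff.2 ⟨hp, by simpa using hpq⟩
  have h_upper (f : ℝ → ℝ≥0∞) (hf : Measurable f) := ENNReal.rpow_le_rpow
    (lintegral_homogeneous_rpow_le hk_hom hpq' hk rfl hf) (one_div_nonneg.2 hp₀.le)
  simp_rw [ENNReal.mul_rpow_of_nonneg _ _ (one_div_nonneg.2 hp₀.le), ← ENNReal.rpow_mul,
    mul_one_div_cancel hp₀.ne', ENNReal.rpow_one] at h_upper
  exact ⟨⟨fun ⟨C, hC_top, hC⟩ => (le_of_hardy hk_hom hp₀ hC).trans_lt hC_top,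
    fun h => ⟨_, h, h_upper⟩⟩, fun _ => h_upper, fun C hC => le_of_hardy hk_hom hp₀ hC⟩
end
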